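/- arXiv:math/0609148 — 2 statements merged into one kernel-verified Lean document; each statement's English description precedes it below -/
import Mathlib

section
/- (From Corollary 1) Let w and w' be braid words on n strands with the same number of letters. Then the Gordon–Litherland forms F(w) and F(w') are equal if and only if w and w' are B0-equivalent. Consequently, the correspondence w ↦ F(w) defines a bijection from the set of braid diagrams (B0-equivalence classes of braid words) onto the set of Gordon–Litherland forms. -/
open Matrix

/-- A letter of a braid word: a pair (column, sign). -/
abbrev Letter : Type := ℕ × ℤ

/-- A cycle on the laundry surface: `Sum.inl i` is the circle cycle `C_i` (1-indexed),
`Sum.inr k` is the band cycle `X_{k+1}` (i.e. the band of the letter in position `k`,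
0-indexed). -/
abbrev Cyc : Type := ℕ ⊕ ℕ

/-- `w` is a braid word on `n` strands: `n ≥ 2`, `w` nonempty, and each letter `(c, ε)`
has column `1 ≤ c ≤ n - 1` and sign `ε = ±1`. -/
def IsBraidWord (n : ℕ) (w : List Letter) : Prop :=
  2 ≤ n ∧ w ≠ [] ∧ ∀ ℓ ∈ w, 1 ≤ ℓ.1 ∧ ℓ.1 ≤ n - 1 ∧ (ℓ.2 = 1 ∨ ℓ.2 = -1)

/-- A single B0 move: swap two adjacent letters whose columns differ by more than 1. -/
inductive B0Step : List Letter → List Letter → Prop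
  | swap (u v : List Letter) (a b : Letter)
      (h : 1 < (a.1 : ℤ) - (b.1 : ℤ) ∨ 1 < (b.1 : ℤ) - (a.1 : ℤ)) :
      B0Step (u ++ a :: b :: v) (u ++ b :: a :: v)

/-- B0-equivalence: a finite sequence of B0 moves. -/
def B0Equiv : List Letter → List Letter → Prop := Relation.ReflTransGen B0Step

/-- The column of the `k`-th letter (0-indexed) of `w`. -/
def colOf (w : List Letter) (k : ℕ) : ℕ := (w.getD k (0, 0)).1

/-- The sign of the `k`-th letter (0-indexed) of `w`. -/
def signOf (w : List Letter) (k : ℕ) : ℤ := (w.getD k (0, 0)).2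

/-- The band cycles `X_k` with column `c_k ∈ {e - 1, e}`, in decreasing order of `k`. -/
def bandBlock (w : List Letter) (e : ℕ) : List Cyc :=
  ((List.range w.length).reverse.filter fun k => colOf w k == e - 1 || colOf w k == e).map
    Sum.inr

/-- The cycles of `w` in laundry order: for each even `e = 2, 4, …, ≤ n` in increasing
order, the circle `C_e` followed by all bands `X_k` with `c_k ∈ {e-1, e}` in decreasing
order of `k`; then the circles `C_i` for odd `i ≤ n` in decreasing order of `i`. -/
def laundryList (n : ℕ) (w : List Letter) : List Cyc :=
  (((List.range (n + 1)).filter fun e => e % 2 == 0 && e != 0).flatMap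
      fun e => Sum.inl e :: bandBlock w e) ++
    ((List.range (n + 1)).filter fun i => i % 2 == 1).reverse.map Sum.inl

/-- The linking number of (the double push-off of) one cycle of `w` with another. -/
def entry (w : List Letter) : Cyc → Cyc → ℤ
  | Sum.inl _, Sum.inl _ => 0
  | Sum.inr k, Sum.inr l =>
      if k = l then signOf w k
      else if (colOf w l = colOf w k + 1 ∧ k < l) ∨ (colOf w l + 1 = colOf w k ∧ l < k) then 1
      else 0
  | Sum.inr k, Sum.inl j =>
      if j = colOf w k then -1 else if j = colOf w k + 1 then 1 else 0
  | Sum.inl j, Sum.inr k =>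
      if j = colOf w k then -1 else if j = colOf w k + 1 then 1 else 0

/-- The linking matrix `M(w)` of a braid word `w` with `m` letters on `n` strands:
the `(n+m) × (n+m)` integer matrix of linking numbers, rows and columns indexed by the
cycles of `w` in laundry order. -/
def linkMat (n m : ℕ) (w : List Letter) : Matrix (Fin (n + m)) (Fin (n + m)) ℤ :=
  fun p q =>
    entry w ((laundryList n w).getD p (Sum.inl 0)) ((laundryList n w).getD q (Sum.inl 0))

/-- The Gordon–Litherland form `F(w)`: `M(w)` with the last row and column (the ones
indexed by the circle cycle `C_1`, last in laundry order) deleted. -/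
def glForm (n m : ℕ) (w : List Letter) :
    Matrix (Fin (n + m - 1)) (Fin (n + m - 1)) ℤ :=
  fun p q =>
    linkMat n m w (Fin.castLE (Nat.sub_le _ _) p) (Fin.castLE (Nat.sub_le _ _) q)

/-! ### Combinatorics of B0-equivalence -/

/-- Two letters commute when their columns differ by more than one. -/
def Letter.Indep (a b : Letter) : Prop :=
  1 < (a.1 : ℤ) - (b.1 : ℤ) ∨ 1 < (b.1 : ℤ) - (a.1 : ℤ)

theorem B0Equiv.cons (a : Letter) {s t : List Letter} (h : B0Equiv s t) :
    B0Equiv (a :: s) (a :: t) := by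
  refine Relation.ReflTransGen.lift (a :: ·) ?_ _ _ h
  rintro _ _ ⟨u, v, b, c, hbc⟩
  exact B0Step.swap (a :: u) v b c hbc

theorem B0Equiv.move (a : Letter) (s t : List Letter) (h : ∀ b ∈ s, Letter.Indep a b) :
    B0Equiv (a :: (s ++ t)) (s ++ a :: t) := by
  induction s with
  | nil => exact Relation.ReflTransGen.refl
  | cons b s ih =>
    exact Relation.ReflTransGen.head (B0Step.swap [] (s ++ t) a b (h b (by simp)))
      (B0Equiv.cons b (ih fun c hc => h c (by simp [hc])))

/-- Two arrangements of the same labelled items are B0-equivalent when every pair of items in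
opposite relative order carries commuting letters. -/
theorem B0Equiv.map_of_perm {α : Type*} (f : α → Letter) (r s : α → α → Prop) {P Q : List α}
    (h : P.Perm Q) (hP : P.Pairwise r) (hQ : Q.Pairwise s)
    (hrs : ∀ x ∈ P, ∀ y ∈ P, r x y → s y x → Letter.Indep (f x) (f y)) :
    B0Equiv (P.map f) (Q.map f) := by
  induction P generalizing Q with
  | nil => rw [← h.nil_eq]; exact Relation.ReflTransGen.refl
  | cons a P ih =>
    obtain ⟨Q₁, Q₂, rfl⟩ := List.append_of_mem (h.subset (List.mem_cons_self))
    have h' : P.Perm (Q₁ ++ Q₂) := (h.trans List.perm_middle).cons_inv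
    rw [List.pairwise_cons] at hP
    rw [List.pairwise_append, List.pairwise_cons] at hQ
    obtain ⟨hQ₁, ⟨-, hQ₂⟩, hQ₁₂⟩ := hQ
    have hrest : B0Equiv (P.map f) ((Q₁ ++ Q₂).map f) := by
      refine ih h' hP.2 ?_ fun x hx y hy => hrs x (by simp [hx]) y (by simp [hy])
      exact List.pairwise_append.2
        ⟨hQ₁, hQ₂, fun x hx y hy => hQ₁₂ x hx y (by simp [hy])⟩
    refine (hrest.cons (f a)).trans ?_
    rw [List.map_append, List.map_append, List.map_cons]
    refine B0Equiv.move _ _ _ ?_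
    simp only [List.mem_map, forall_exists_index, and_imp, forall_apply_eq_imp_iff₂]
    intro q hq
    have hqP : q ∈ P := h'.symm.subset (by simp [hq])
    exact hrs a (by simp) q (by simp [hqP]) (hP.1 q hqP) (hQ₁₂ q hq a (by simp))

theorem List.exists_perm_map_eq_range {α : Type*} (f : α → ℕ) {V : List α} {m : ℕ}
    (h : (V.map f).Perm (List.range m)) :
    ∃ P : List α, P.Perm V ∧ P.map f = List.range m ∧ P.Pairwise fun x y => f x < f y := by
  let P := V.mergeSort fun x y => decide (f x ≤ f y)
  have hPV : P.Perm V := List.mergeSort_perm _ _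
  have hsort : (P.map f).Pairwise (· ≤ ·) := by
    rw [List.pairwise_map]
    refine (List.pairwise_mergeSort (le := fun x y => decide (f x ≤ f y)) ?_ ?_ V).imp ?_
    · intro a b c; simpa using le_trans
    · intro a b; simpa using le_total _ _
    · intro a b; simp
  have hmap : P.map f = List.range m :=
    ((hPV.map f).trans h).eq_of_pairwise (fun a b _ _ => le_antisymm) hsort
      (List.pairwise_lt_range.imp le_of_lt)
  refine ⟨P, hPV, hmap, ?_⟩
  rw [← List.pairwise_map, hmap]
  exact List.pairwise_lt_range

theorem List.map_getD_range {α : Type*} (w : List α) (d : α) :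
    (List.range w.length).map (fun k => w.getD k d) = w := by
  refine List.ext_getElem (by simp) fun i h₁ h₂ => ?_
  simp [h₂]

/-! ### The laundry order -/

/-- The even labels `2, 4, …, ≤ n`. -/
def evens (n : ℕ) : List ℕ := (List.range (n + 1)).filter fun e => e % 2 == 0 && e != 0

/-- The odd labels `1, 3, …, ≤ n`. -/
def odds (n : ℕ) : List ℕ := (List.range (n + 1)).filter fun i => i % 2 == 1

/-- The positions of the bands in the block of `C_e`, in laundry order. -/
def bandIdx (w : List Letter) (e : ℕ) : List ℕ :=
  (List.range w.length).reverse.filter fun k => colOf w k == e - 1 || colOf w k == e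

/-- The laundry order without the final circle `C_1`. -/
def laundryInit (n : ℕ) (w : List Letter) : List Cyc :=
  ((evens n).flatMap fun e => Sum.inl e :: (bandIdx w e).map Sum.inr) ++
    (odds n).tail.reverse.map Sum.inl

theorem mem_evens {n e : ℕ} : e ∈ evens n ↔ e ≤ n ∧ e % 2 = 0 ∧ e ≠ 0 := by
  simp [evens]

theorem nodup_evens (n : ℕ) : (evens n).Nodup := List.nodup_range.filter _

theorem mem_bandIdx {w : List Letter} {e k : ℕ} :
    k ∈ bandIdx w e ↔ k < w.length ∧ (colOf w k = e - 1 ∨ colOf w k = e) := by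
  simp [bandIdx]

theorem pairwise_bandIdx (w : List Letter) (e : ℕ) : (bandIdx w e).Pairwise (· > ·) :=
  (List.pairwise_reverse.2 List.pairwise_lt_range).filter _

theorem length_evens_add_length_odds (n : ℕ) : (evens n).length + (odds n).length = n := by
  induction n with
  | zero => simp [evens, odds]
  | succ n ih =>
    simp only [evens, odds] at ih ⊢
    rw [List.range_succ, List.filter_append, List.filter_append, List.length_append,
      List.length_append]
    rcases Nat.mod_two_eq_zero_or_one (n + 1) with h | h <;> simp [h] <;> omega

theorem odds_eq_cons_tail {n : ℕ} (hn : 1 ≤ n) : odds n = 1 :: (odds n).tail := by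
  obtain ⟨k, rfl⟩ := Nat.exists_eq_add_of_le' hn
  simp [odds, List.range_succ_eq_map]

theorem laundryList_eq {n : ℕ} (hn : 1 ≤ n) (w : List Letter) :
    laundryList n w = laundryInit n w ++ [Sum.inl 1] := by
  change ((evens n).flatMap fun e => Sum.inl e :: (bandIdx w e).map Sum.inr) ++
    (odds n).reverse.map Sum.inl = _
  rw [odds_eq_cons_tail hn]
  simp [laundryInit]

theorem colOf_signOf_of_isBraidWord {n : ℕ} {w : List Letter} (hw : IsBraidWord n w) {k : ℕ}
    (hk : k < w.length) :
    1 ≤ colOf w k ∧ colOf w k ≤ n - 1 ∧ (signOf w k = 1 ∨ signOf w k = -1) := by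
  have := hw.2.2 w[k] (List.getElem_mem hk)
  simpa [colOf, signOf, hk] using this

theorem flatMap_bandIdx_perm {n : ℕ} {w : List Letter} (hw : IsBraidWord n w) :
    ((evens n).flatMap (bandIdx w)).Perm (List.range w.length) := by
  rw [List.perm_ext_iff_of_nodup _ List.nodup_range]
  · intro k
    simp only [List.mem_flatMap, mem_evens, mem_bandIdx, List.mem_range]
    constructor
    · rintro ⟨e, -, hk, -⟩
      exact hk
    · intro hk
      obtain ⟨h₁, h₂, -⟩ := colOf_signOf_of_isBraidWord hw hk
      have := hw.1
      rcases Nat.mod_two_eq_zero_or_one (colOf w k) with h | h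
      · exact ⟨colOf w k, by omega, hk, Or.inr rfl⟩
      · exact ⟨colOf w k + 1, by omega, hk, Or.inl rfl⟩
  · rw [List.nodup_flatMap]
    refine ⟨fun e _ => (pairwise_bandIdx w e).imp fun h => ne_of_gt h, ?_⟩
    refine (nodup_evens n).imp_of_mem fun {a b} ha hb hab => ?_
    rw [mem_evens] at ha hb
    intro k hka hkb
    rw [mem_bandIdx] at hka hkb
    omega

theorem length_laundryInit {n : ℕ} {w : List Letter} (hw : IsBraidWord n w) :
    (laundryInit n w).length = n + w.length - 1 := by
  have h₁ := (flatMap_bandIdx_perm hw).length_eq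
  have h₂ := length_evens_add_length_odds n
  have h₃ := congrArg List.length (odds_eq_cons_tail (n := n) (by have := hw.1; omega))
  have h₄ : ∀ E : List ℕ, (E.flatMap fun e => (Sum.inl e : Cyc) :: (bandIdx w e).map Sum.inr).length
      = E.length + (E.flatMap (bandIdx w)).length := by
    intro E
    induction E with
    | nil => simp
    | cons e E ih => simp only [List.flatMap_cons, List.length_append, ih]; simp; omega
  rw [List.length_range] at h₁
  rw [List.length_cons] at h₃
  simp only [laundryInit, List.length_append, h₄, List.length_map, List.length_reverse, h₁]
  omega

/-! ### Invariance under B0 moves -/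

theorem getD_append_swap (u v : List Letter) (a b : Letter) (k : ℕ) :
    (u ++ b :: a :: v).getD (Equiv.swap u.length (u.length + 1) k) (0, 0) =
      (u ++ a :: b :: v).getD k (0, 0) := by
  rcases lt_trichotomy k u.length with h | h | h
  · rw [Equiv.swap_apply_of_ne_of_ne (by omega) (by omega)]
    simp [List.getElem?_append_left h]
  · subst h; simp
  · rcases eq_or_ne k (u.length + 1) with rfl | h'
    · simp
    · rw [Equiv.swap_apply_of_ne_of_ne (by omega) h']
      obtain ⟨j, rfl⟩ : ∃ j, k = u.length + (j + 2) := ⟨k - u.length - 2, by omega⟩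
      simp [List.getElem?_append_right]

theorem swap_succ_lt_swap_succ {i k l : ℕ} (hkl : k < l) (h : ¬ (k = i ∧ l = i + 1)) :
    Equiv.swap i (i + 1) k < Equiv.swap i (i + 1) l := by
  simp only [Equiv.swap_apply_def]
  split_ifs <;> omega

theorem swap_succ_lt_iff {i k l : ℕ} (h₁ : ¬ (k = i ∧ l = i + 1)) (h₂ : ¬ (k = i + 1 ∧ l = i)) :
    Equiv.swap i (i + 1) k < Equiv.swap i (i + 1) l ↔ k < l := by
  simp only [Equiv.swap_apply_def]
  split_ifs <;> omega

theorem glForm_eq_of_b0Step (n m : ℕ) {w w' : List Letter} (h : B0Step w w') :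
    glForm n m w = glForm n m w' := by
  obtain ⟨u, v, a, b, hab⟩ := h
  set w := u ++ a :: b :: v with hw
  set w' := u ++ b :: a :: v with hw'
  set i := u.length with hi
  let σ := Equiv.swap i (i + 1)
  have hlen : w'.length = w.length := by simp [hw, hw']
  have hilt : i + 1 < w.length := by simp [hw, hi]
  have hσlt : ∀ k, σ k < w.length ↔ k < w.length := by
    intro k
    simp only [σ, Equiv.swap_apply_def]
    split_ifs <;> omega
  have hcol : ∀ k, colOf w' (σ k) = colOf w k := fun k =>
    congrArg Prod.fst (getD_append_swap u v a b k)
  have hsign : ∀ k, signOf w' (σ k) = signOf w k := fun k =>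
    congrArg Prod.snd (getD_append_swap u v a b k)
  have hcol₀ : colOf w i = a.1 := by simp [colOf, hw, hi]
  have hcol₁ : colOf w (i + 1) = b.1 := by simp [colOf, hw, hi]
  have hidx : ∀ e, bandIdx w' e = (bandIdx w e).map σ := by
    intro e
    have hmono : ((bandIdx w e).map σ).Pairwise (· > ·) := by
      rw [List.pairwise_map]
      refine (pairwise_bandIdx w e).imp_of_mem fun {k l} hk hl hkl => ?_
      refine swap_succ_lt_swap_succ hkl ?_
      rintro ⟨rfl, rfl⟩
      rw [mem_bandIdx] at hk hl
      omega
    refine List.Perm.eq_of_pairwise (le := (· > ·)) (fun a b _ _ h₁ h₂ => by omega)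
      (pairwise_bandIdx w' e) hmono ?_
    rw [List.perm_ext_iff_of_nodup ((pairwise_bandIdx w' e).imp fun h => ne_of_gt h)
      (hmono.imp fun h => ne_of_gt h)]
    intro k
    obtain ⟨k, rfl⟩ := σ.surjective k
    rw [List.mem_map_of_injective σ.injective, mem_bandIdx, mem_bandIdx, hlen, hcol, hσlt]
  have hlist : laundryList n w' = (laundryList n w).map (Sum.map id σ) := by
    change ((evens n).flatMap fun e => Sum.inl e :: (bandIdx w' e).map Sum.inr) ++
      (odds n).reverse.map Sum.inl = (((evens n).flatMap fun e => Sum.inl e ::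
        (bandIdx w e).map Sum.inr) ++ (odds n).reverse.map Sum.inl).map _
    simp [hidx, List.map_flatMap, Function.comp_def]
  have hentry : ∀ x y : Cyc, entry w' (Sum.map id σ x) (Sum.map id σ y) = entry w x y := by
    rintro (x | k) (y | l)
    · rfl
    · simp [entry, hcol]
    · simp [entry, hcol]
    · simp only [entry, Sum.map_inr, hcol, hsign, σ.injective.eq_iff]
      by_cases hk : k = i ∧ l = i + 1
      · obtain ⟨rfl, rfl⟩ := hk
        rw [hcol₀, hcol₁, if_neg (by omega), if_neg (by omega), if_neg (by omega),
          if_neg (by omega)]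
      · by_cases hl : k = i + 1 ∧ l = i
        · obtain ⟨rfl, rfl⟩ := hl
          rw [hcol₀, hcol₁, if_neg (by omega), if_neg (by omega), if_neg (by omega),
            if_neg (by omega)]
        · simp only [σ, swap_succ_lt_iff hk hl,
            swap_succ_lt_iff (i := i) (k := l) (l := k) (by omega) (by omega)]
  have hget : ∀ p, (laundryList n w').getD p (Sum.inl 0) =
      Sum.map id σ ((laundryList n w).getD p (Sum.inl 0)) := by
    intro p
    rw [hlist]
    exact List.getD_map (laundryList n w) (Sum.inl 0) (Sum.map id σ)
  funext p q
  simp only [glForm, linkMat, hget, hentry]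

/-! ### Recovering the braid from the form -/

theorem eq_of_append_eq_append_of_ne_zero {s s' R R' : List ℤ} (hs : ∀ x ∈ s, x ≠ 0)
    (hs' : ∀ x ∈ s', x ≠ 0) (hR : ∀ x ∈ R.head?, x = 0) (hR' : ∀ x ∈ R'.head?, x = 0)
    (h : s ++ R = s' ++ R') : s = s' ∧ R = R' := by
  induction s generalizing s' with
  | nil =>
    cases s' with
    | nil => exact ⟨rfl, h⟩
    | cons x s' =>
      obtain rfl : R = x :: (s' ++ R') := h
      exact absurd (hR x (by simp)) (hs' x (by simp))
  | cons x s ih =>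
    cases s' with
    | nil =>
      obtain rfl : x :: (s ++ R) = R' := h
      exact absurd (hR' x (by simp)) (hs x (by simp))
    | cons y s' =>
      simp only [List.cons_append, List.cons.injEq] at h
      obtain ⟨rfl, h⟩ := h
      obtain ⟨rfl, hRR'⟩ :=
        ih (fun z hz => hs z (by simp [hz])) (fun z hz => hs' z (by simp [hz])) h
      exact ⟨rfl, hRR'⟩

/-- Blocks of nonzero integers separated by zeros can be read off from their concatenation. -/
theorem eq_of_flatMap_zero_cons_eq {E : List ℕ} {s s' : ℕ → List ℤ} {T : List ℤ}
    (hs : ∀ e ∈ E, ∀ x ∈ s e, x ≠ 0) (hs' : ∀ e ∈ E, ∀ x ∈ s' e, x ≠ 0)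
    (hT : ∀ x ∈ T, x = 0)
    (h : E.flatMap (fun e => 0 :: s e) ++ T = E.flatMap (fun e => 0 :: s' e) ++ T) :
    ∀ e ∈ E, s e = s' e := by
  have hhead : ∀ (E : List ℕ) (s : ℕ → List ℤ),
      ∀ x ∈ (E.flatMap (fun e => 0 :: s e) ++ T).head?, x = 0 := by
    intro E s x hx
    cases E with
    | nil => exact hT x (List.mem_of_mem_head? hx)
    | cons e E => simpa using hx.symm
  induction E with
  | nil => simp
  | cons e E ih =>
    simp only [List.flatMap_cons, List.cons_append, List.append_assoc, List.cons.injEq,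
      true_and] at h
    obtain ⟨h₁, h₂⟩ := eq_of_append_eq_append_of_ne_zero (hs e (by simp)) (hs' e (by simp))
      (hhead E s) (hhead E s') h
    have := ih (fun e he => hs e (by simp [he])) (fun e he => hs' e (by simp [he])) h₂
    simpa [h₁] using this

theorem List.zip_flatMap_flatMap {ι α β : Type*} (E : List ι) (f : ι → List α) (g : ι → List β)
    (h : ∀ e ∈ E, (f e).length = (g e).length) :
    (E.flatMap f).zip (E.flatMap g) = E.flatMap fun e => (f e).zip (g e) := by
  induction E with
  | nil => rfl
  | cons e E ih =>
    simp only [List.flatMap_cons]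
    rw [List.zip_append (h e (by simp)), ih fun e he => h e (by simp [he])]

theorem List.length_flatMap_congr {ι α β : Type*} (E : List ι) (f : ι → List α) (g : ι → List β)
    (h : ∀ e ∈ E, (f e).length = (g e).length) :
    (E.flatMap f).length = (E.flatMap g).length := by
  simp only [List.length_flatMap]
  rw [List.map_congr_left h]

theorem pairwise_zip_gt {s t : List ℕ} (hs : s.Pairwise (· > ·)) (ht : t.Pairwise (· > ·)) :
    (s.zip t).Pairwise fun x y => x.1 > y.1 ∧ x.2 > y.2 := by
  induction s generalizing t with
  | nil => simp
  | cons a s ih =>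
    cases t with
    | nil => simp
    | cons b t =>
      rw [List.pairwise_cons] at hs ht
      rw [List.zip_cons_cons, List.pairwise_cons]
      refine ⟨fun z hz => ?_, ih hs.2 ht.2⟩
      obtain ⟨h₁, h₂⟩ := List.of_mem_zip (a := z.1) (b := z.2) hz
      exact ⟨hs.1 _ h₁, ht.1 _ h₂⟩

theorem glForm_apply {n m : ℕ} {w : List Letter} (hw : IsBraidWord n w) (hm : w.length = m)
    (p q : Fin (n + m - 1)) :
    glForm n m w p q =
      entry w ((laundryInit n w)[p]'(by rw [length_laundryInit hw, hm]; exact p.2))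
        ((laundryInit n w)[q]'(by rw [length_laundryInit hw, hm]; exact q.2)) := by
  have hp : (p : ℕ) < (laundryInit n w).length := by
    rw [length_laundryInit hw, hm]; exact p.2
  have hq : (q : ℕ) < (laundryInit n w).length := by
    rw [length_laundryInit hw, hm]; exact q.2
  simp [glForm, linkMat, laundryList_eq (by have := hw.1; omega : 1 ≤ n) w,
    List.getElem?_append_left hp, List.getElem?_append_left hq, hp, hq]

/-- Cycles in the same position of the laundry order have the same linking numbers when the
forms agree. -/
theorem entry_eq_of_mem_zip {n m : ℕ} {w w' : List Letter} (hw : IsBraidWord n w)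
    (hw' : IsBraidWord n w') (hm : w.length = m) (hm' : w'.length = m)
    (h : glForm n m w = glForm n m w') {x y : Cyc × Cyc}
    (hx : x ∈ (laundryInit n w).zip (laundryInit n w'))
    (hy : y ∈ (laundryInit n w).zip (laundryInit n w')) :
    entry w x.1 y.1 = entry w' x.2 y.2 := by
  obtain ⟨p, hp, rfl⟩ := List.getElem_of_mem hx
  obtain ⟨q, hq, rfl⟩ := List.getElem_of_mem hy
  simp only [List.length_zip, length_laundryInit hw, length_laundryInit hw', hm, hm',
    min_self] at hp hq
  have := congrFun (congrFun h ⟨p, hp⟩) ⟨q, hq⟩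
  rw [glForm_apply hw hm, glForm_apply hw' hm'] at this
  simpa using this

theorem length_bandIdx_eq {n m : ℕ} {w w' : List Letter} (hw : IsBraidWord n w)
    (hw' : IsBraidWord n w') (hm : w.length = m) (hm' : w'.length = m)
    (h : glForm n m w = glForm n m w') :
    ∀ e ∈ evens n, (bandIdx w e).length = (bandIdx w' e).length := by
  have hdiag : (laundryInit n w).map (fun x => entry w x x) =
      (laundryInit n w').map (fun x => entry w' x x) := by
    have hlen : (laundryInit n w).length = (laundryInit n w').length := by
      rw [length_laundryInit hw, length_laundryInit hw', hm, hm']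
    refine List.ext_getElem (by simp [hlen]) fun p h₁ h₂ => ?_
    simp only [List.length_map] at h₁ h₂
    have hmem : ((laundryInit n w)[p], (laundryInit n w')[p]) ∈
        (laundryInit n w).zip (laundryInit n w') := by
      rw [← List.getElem_zip (h := by simp [h₁, h₂])]
      exact List.getElem_mem _
    simpa using entry_eq_of_mem_zip hw hw' hm hm' h hmem hmem
  have hsplit : ∀ w : List Letter, (laundryInit n w).map (fun x => entry w x x) =
      ((evens n).flatMap fun e => 0 :: (bandIdx w e).map (signOf w)) ++
        (odds n).tail.map fun _ => (0 : ℤ) := by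
    intro w
    simp [laundryInit, List.map_flatMap, entry, Function.comp_def]
  rw [hsplit, hsplit] at hdiag
  have hne : ∀ {w : List Letter}, IsBraidWord n w → ∀ e ∈ evens n,
      ∀ x ∈ (bandIdx w e).map (signOf w), x ≠ 0 := by
    intro w hw e _ x hx
    obtain ⟨k, hk, rfl⟩ := List.mem_map.1 hx
    have := (colOf_signOf_of_isBraidWord hw (mem_bandIdx.1 hk).1).2.2
    omega
  intro e he
  have := eq_of_flatMap_zero_cons_eq (hne hw) (hne hw') (by simp) hdiag e he
  simpa using congrArg List.length this

theorem b0Equiv_of_glForm_eq {n m : ℕ} {w w' : List Letter} (hw : IsBraidWord n w)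
    (hw' : IsBraidWord n w') (hm : w.length = m) (hm' : w'.length = m)
    (h : glForm n m w = glForm n m w') : B0Equiv w w' := by
  have hlen := length_bandIdx_eq hw hw' hm hm' h
  let V : List (ℕ × ℕ) := (evens n).flatMap fun e => (bandIdx w e).zip (bandIdx w' e)
  have hV : V = ((evens n).flatMap (bandIdx w)).zip ((evens n).flatMap (bandIdx w')) :=
    (List.zip_flatMap_flatMap _ _ _ hlen).symm
  have hVlen := List.length_flatMap_congr _ _ _ hlen
  have hV₁ : (V.map Prod.fst).Perm (List.range m) := by
    rw [hV, List.map_fst_zip hVlen.le, ← hm]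
    exact flatMap_bandIdx_perm hw
  have hV₂ : (V.map Prod.snd).Perm (List.range m) := by
    rw [hV, List.map_snd_zip hVlen.ge, ← hm']
    exact flatMap_bandIdx_perm hw'
  have hZ : (laundryInit n w).zip (laundryInit n w') =
      ((evens n).flatMap fun e => ((Sum.inl e : Cyc) :: (bandIdx w e).map Sum.inr).zip
        ((Sum.inl e : Cyc) :: (bandIdx w' e).map Sum.inr)) ++
        ((odds n).tail.reverse.map Sum.inl).zip ((odds n).tail.reverse.map Sum.inl) := by
    have hlen' : ∀ e ∈ evens n, ((Sum.inl e : Cyc) :: (bandIdx w e).map Sum.inr).length =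
        ((Sum.inl e : Cyc) :: (bandIdx w' e).map Sum.inr).length := fun e he => by
      simp [hlen e he]
    rw [laundryInit, laundryInit, List.zip_append (List.length_flatMap_congr _ _ _ hlen'),
      List.zip_flatMap_flatMap _ _ _ hlen']
  have hcircle : ∀ e ∈ evens n, ((Sum.inl e : Cyc), (Sum.inl e : Cyc)) ∈
      (laundryInit n w).zip (laundryInit n w') := by
    intro e he
    rw [hZ]
    exact List.mem_append_left _ (List.mem_flatMap.2 ⟨e, he, by simp⟩)
  have hband : ∀ z ∈ V, ((Sum.inr z.1 : Cyc), (Sum.inr z.2 : Cyc)) ∈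
      (laundryInit n w).zip (laundryInit n w') := by
    intro z hz
    obtain ⟨e, he, hz⟩ := List.mem_flatMap.1 hz
    rw [hZ]
    refine List.mem_append_left _ (List.mem_flatMap.2 ⟨e, he, ?_⟩)
    rw [List.zip_cons_cons, List.zip_map]
    exact List.mem_cons_of_mem _ (List.mem_map_of_mem (f := Prod.map Sum.inr Sum.inr) hz)
  have hentry {x y : Cyc × Cyc} := entry_eq_of_mem_zip hw hw' hm hm' h (x := x) (y := y)
  have hsign : ∀ z ∈ V, signOf w z.1 = signOf w' z.2 := by
    intro z hz
    simpa [entry] using hentry (hband z hz) (hband z hz)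
  have hcol : ∀ z ∈ V, colOf w z.1 = colOf w' z.2 := by
    intro z hz
    have hz' := hz
    obtain ⟨e, he, hz'⟩ := List.mem_flatMap.1 hz'
    obtain ⟨h₁, h₂⟩ := List.of_mem_zip (a := z.1) (b := z.2) hz'
    have := hentry (hband z hz) (hcircle e he)
    rw [mem_evens] at he
    rw [mem_bandIdx] at h₁ h₂
    simp only [entry] at this
    split_ifs at this <;> omega
  have hletter : ∀ z ∈ V, w.getD z.1 (0, 0) = w'.getD z.2 (0, 0) := fun z hz =>
    Prod.ext (hcol z hz) (hsign z hz)
  obtain ⟨P, hPV, hP, hPlt⟩ := List.exists_perm_map_eq_range Prod.fst hV₁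
  obtain ⟨Q, hQV, hQ, hQlt⟩ := List.exists_perm_map_eq_range Prod.snd hV₂
  have hPw : P.map (fun z => w.getD z.1 (0, 0)) = w := by
    have := List.map_getD_range w (0, 0)
    rwa [hm, ← hP, List.map_map] at this
  have hQw : Q.map (fun z => w.getD z.1 (0, 0)) = w' := by
    have := List.map_getD_range w' (0, 0)
    rw [hm', ← hQ, List.map_map] at this
    rw [List.map_congr_left fun z hz => hletter z (hQV.subset hz)]
    exact this
  rw [← hPw, ← hQw]
  refine B0Equiv.map_of_perm _ _ _ (hPV.trans hQV.symm) hPlt hQlt fun x hx y hy hxy hyx => ?_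
  replace hx := hPV.subset hx
  replace hy := hPV.subset hy
  by_contra hdep
  change ¬ (1 < (colOf w x.1 : ℤ) - (colOf w y.1 : ℤ) ∨
    1 < (colOf w y.1 : ℤ) - (colOf w x.1 : ℤ)) at hdep
  have hcx := hcol x hx
  have hcy := hcol y hy
  by_cases hxyc : colOf w x.1 = colOf w y.1
  · obtain ⟨e, he, hxe⟩ := List.mem_flatMap.1 hx
    obtain ⟨e', he', hye⟩ := List.mem_flatMap.1 hy
    have h₁ := (List.of_mem_zip (a := x.1) (b := x.2) hxe).1
    have h₂ := (List.of_mem_zip (a := y.1) (b := y.2) hye).1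
    rw [mem_evens] at he he'
    rw [mem_bandIdx] at h₁ h₂
    obtain rfl : e = e' := by omega
    have hpw := List.pairwise_iff_getElem.1
      (pairwise_zip_gt (pairwise_bandIdx w e) (pairwise_bandIdx w' e))
    obtain ⟨p, hp, rfl⟩ := List.getElem_of_mem hxe
    obtain ⟨q, hq, rfl⟩ := List.getElem_of_mem hye
    rcases lt_trichotomy p q with hpq | rfl | hpq
    · exact absurd (hpw p q hp hq hpq).1 hxy.not_gt
    · exact lt_irrefl _ hxy
    · exact absurd (hpw q p hq hp hpq).2 hyx.not_gt
  · have := hentry (hband x hx) (hband y hy)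
    simp only [entry] at this
    split_ifs at this <;> omega

/-- **from Corollary 1.** For braid words on `n` strands with the same
number of letters, the Gordon–Litherland forms are equal if and only if the words are
B0-equivalent; i.e. `w ↦ F(w)` is a bijection from braid diagrams onto
Gordon–Litherland forms. -/
theorem glForm_eq_iff_b0Equiv (n m : ℕ) (w w' : List Letter)
    (hw : IsBraidWord n w) (hw' : IsBraidWord n w')
    (hm : w.length = m) (hm' : w'.length = m) :
    glForm n m w = glForm n m w' ↔ B0Equiv w w' := by
  refine ⟨b0Equiv_of_glForm_eq hw hw' hm hm', fun h => ?_⟩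
  clear hw' hm'
  induction h with
  | refl => rfl
  | tail _ hstep ih => exact ih.trans (glForm_eq_of_b0Step n m hstep)
end

section
/- (Type III Reidemeister move M4) Let u and v be (possibly empty) lists of letters, let i ∈ {1, …, n−2} and ε ∈ {+1, −1}, and let w = u ++ [(i,ε), (i+1,ε), (i,ε)] ++ v and w' = u ++ [(i+1,ε), (i,ε), (i+1,ε)] ++ v be braid words on n strands related by the braid relation σ_i σ_{i+1} σ_i = σ_{i+1} σ_i σ_{i+1} (or its all-negative version). Then there exists a unimodular integer matrix P (det P = ±1) such that M(w') = Pᵀ · M(w) · P; that is, the linking matrices of the two words are unimodular-congruent. -/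
open Matrix

/-- The finite set of cycles of a braid word with `m` letters on `n` strands. -/
def cycleFinset (n m : ℕ) : Finset Cyc := (Finset.Icc 1 n).disjSum (Finset.range m)

theorem inl_mem_cycleFinset {n m j : ℕ} :
    (Sum.inl j : Cyc) ∈ cycleFinset n m ↔ 1 ≤ j ∧ j ≤ n := by
  simp [cycleFinset]

theorem inr_mem_cycleFinset {n m k : ℕ} :
    (Sum.inr k : Cyc) ∈ cycleFinset n m ↔ k < m := by
  simp [cycleFinset]

theorem inl_not_mem_bandBlock (w : List Letter) (e j : ℕ) : Sum.inl j ∉ bandBlock w e := by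
  simp [bandBlock]

theorem inr_mem_bandBlock {w : List Letter} {e k : ℕ} :
    Sum.inr k ∈ bandBlock w e ↔ k < w.length ∧ (colOf w k = e - 1 ∨ colOf w k = e) := by
  simp [bandBlock]

theorem nodup_bandBlock (w : List Letter) (e : ℕ) : (bandBlock w e).Nodup :=
  ((List.nodup_reverse.2 List.nodup_range).filter _).map Sum.inr_injective

theorem nodup_laundryList (n : ℕ) (w : List Letter) : (laundryList n w).Nodup := by
  refine List.Nodup.append ?_ ?_ ?_
  · rw [List.nodup_flatMap]
    refine ⟨fun e _ => List.nodup_cons.2 ⟨inl_not_mem_bandBlock w e e, nodup_bandBlock w e⟩, ?_⟩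
    refine (List.nodup_range.filter _).pairwise_of_forall_ne ?_
    intro e he e' he' hne x hx hx'
    simp only [List.mem_filter, List.mem_range, Bool.and_eq_true, beq_iff_eq, bne_iff_ne] at he he'
    rcases x with j | k
    · simp only [List.mem_cons, inl_not_mem_bandBlock, or_false, Sum.inl.injEq] at hx hx'
      omega
    · simp only [List.mem_cons, reduceCtorEq, inr_mem_bandBlock, false_or] at hx hx'
      omega
  · exact (List.nodup_reverse.2 (List.nodup_range.filter _)).map Sum.inl_injective
  · intro x hx hx'
    rcases x with j | k
    · simp [inl_not_mem_bandBlock] at hx hx'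
      omega
    · simp at hx'

theorem toFinset_laundryList {n : ℕ} {w : List Letter} (hw : IsBraidWord n w) :
    (laundryList n w).toFinset = cycleFinset n w.length := by
  ext x
  rw [List.mem_toFinset]
  rcases x with j | k
  · rw [inl_mem_cycleFinset]
    simp [laundryList, inl_not_mem_bandBlock]
    omega
  · rw [inr_mem_cycleFinset]
    simp only [laundryList, List.mem_append, List.mem_flatMap, List.mem_filter, List.mem_range,
      Bool.and_eq_true, beq_iff_eq, bne_iff_ne, List.mem_cons, reduceCtorEq, inr_mem_bandBlock,
      false_or, List.mem_map, and_false, exists_false, or_false]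
    refine ⟨fun ⟨_, _, h, _⟩ => h, fun h => ?_⟩
    obtain ⟨h1, h2, -⟩ := hw.2.2 w[k] (List.getElem_mem h)
    have hc : colOf w k = w[k].1 := by simp [colOf, h]
    have := hw.1
    rcases Nat.mod_two_eq_zero_or_one (colOf w k) with h0 | h0
    · exact ⟨colOf w k, by omega, h, by omega⟩
    · exact ⟨colOf w k + 1, by omega, h, by omega⟩

theorem length_laundryList {n : ℕ} {w : List Letter} (hw : IsBraidWord n w) :
    (laundryList n w).length = n + w.length := by
  rw [← List.toFinset_card_of_nodup (nodup_laundryList n w), toFinset_laundryList hw]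
  simp [cycleFinset]

/-- In laundry order, the linking matrix is a reindexing of the matrix of linking numbers. -/
theorem exists_linkMat_eq_submatrix {n m : ℕ} {w : List Letter} (hw : IsBraidWord n w)
    (hm : w.length = m) :
    ∃ e : Fin (n + m) ≃ cycleFinset n m,
      linkMat n m w = (Matrix.of fun x y : cycleFinset n m => entry w x y).submatrix e e := by
  subst hm
  have hl := length_laundryList hw
  have hmem : ∀ x, x ∈ laundryList n w ↔ x ∈ cycleFinset n w.length := fun x => by
    rw [← toFinset_laundryList hw, List.mem_toFinset]
  refine ⟨(finCongr hl.symm).trans ((nodup_laundryList n w).getEquiv.trans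
    (Equiv.subtypeEquivRight hmem)), ?_⟩
  ext p q
  have hp : (p : ℕ) < (laundryList n w).length := hl.symm ▸ p.isLt
  have hq : (q : ℕ) < (laundryList n w).length := hl.symm ▸ q.isLt
  simp [linkMat, hp, hq]

theorem Matrix.submatrix_congruence {R ι κ : Type*} [CommRing R] [Fintype ι] [Fintype κ]
    {A B Q : Matrix κ κ R} (h : B = Qᵀ * A * Q) (e f : ι ≃ κ) :
    B.submatrix f f = (Q.submatrix e f)ᵀ * A.submatrix e e * Q.submatrix e f := by
  rw [Matrix.transpose_submatrix, Matrix.submatrix_mul_equiv, Matrix.submatrix_mul_equiv, h]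

section Braid

variable {n a m : ℕ} (h : a + 2 < m) (ε : ℤ)

/-- The band cycle `X_{k+1}`, as an element of the set of cycles. -/
def bandCycle (n : ℕ) {m k : ℕ} (h : k < m) : cycleFinset n m :=
  ⟨Sum.inr k, inr_mem_cycleFinset.2 h⟩

/-- The base change of the braid relation, performed on the bands in positions `a`, `a + 1` and
`a + 2`: the columns express the new cycles in terms of the old ones. -/
def braidMatrix : Matrix (cycleFinset n m) (cycleFinset n m) ℤ :=
  Matrix.of fun x y =>
    if (y : Cyc) = Sum.inr a then (Pi.single (bandCycle n (k := a + 1) (by omega)) 1 : _ → ℤ) x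
    else if (y : Cyc) = Sum.inr (a + 1) then (Pi.single (bandCycle n h) 1 : _ → ℤ) x
    else if (y : Cyc) = Sum.inr (a + 2) then
      (Pi.single (bandCycle n (k := a + 1) (by omega)) 1
        - Pi.single (bandCycle n (k := a) (by omega)) ε + Pi.single (bandCycle n h) ε : _ → ℤ) x
    else (Pi.single y 1 : _ → ℤ) x

/-- The inverse of `braidMatrix`. -/
def braidMatrixInv : Matrix (cycleFinset n m) (cycleFinset n m) ℤ :=
  Matrix.of fun x y =>
    if (y : Cyc) = Sum.inr (a + 1) then (Pi.single (bandCycle n (k := a) (by omega)) 1 : _ → ℤ) x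
    else if (y : Cyc) = Sum.inr (a + 2) then
      (Pi.single (bandCycle n (k := a + 1) (by omega)) 1 : _ → ℤ) x
    else if (y : Cyc) = Sum.inr a then
      (Pi.single (bandCycle n (k := a) (by omega)) ε
        + Pi.single (bandCycle n (k := a + 1) (by omega)) 1
        - Pi.single (bandCycle n h) ε : _ → ℤ) x
    else (Pi.single y 1 : _ → ℤ) x

theorem mul_braidMatrix (A : Matrix (cycleFinset n m) (cycleFinset n m) ℤ)
    (x y : cycleFinset n m) :
    (A * braidMatrix (n := n) h ε) x y =
      if (y : Cyc) = Sum.inr a then A x (bandCycle n (k := a + 1) (by omega))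
      else if (y : Cyc) = Sum.inr (a + 1) then A x (bandCycle n h)
      else if (y : Cyc) = Sum.inr (a + 2) then
        A x (bandCycle n (k := a + 1) (by omega)) - A x (bandCycle n (k := a) (by omega)) * ε
          + A x (bandCycle n h) * ε
      else A x y := by
  change (fun z => A x z) ⬝ᵥ (fun z => braidMatrix (n := n) h ε z y) = _
  unfold braidMatrix
  simp only [Matrix.of_apply]
  split_ifs
  · exact (dotProduct_single _ _ _).trans (mul_one _)
  · exact (dotProduct_single _ _ _).trans (mul_one _)
  · change _ ⬝ᵥ (Pi.single (M := fun _ => ℤ) _ 1 - Pi.single (M := fun _ => ℤ) _ ε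
      + Pi.single (M := fun _ => ℤ) _ ε) = _
    rw [dotProduct_add, dotProduct_sub]
    simp only [dotProduct_single, mul_one]
  · exact (dotProduct_single _ _ _).trans (mul_one _)

theorem transpose_braidMatrix_mul_mul (A : Matrix (cycleFinset n m) (cycleFinset n m) ℤ)
    (x y : cycleFinset n m) :
    ((braidMatrix (n := n) h ε)ᵀ * A * braidMatrix (n := n) h ε) x y =
      (((A * braidMatrix (n := n) h ε)ᵀ) * braidMatrix (n := n) h ε) y x := by
  rw [Matrix.mul_assoc, ← Matrix.transpose_apply ((braidMatrix h ε)ᵀ * _), Matrix.transpose_mul,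
    Matrix.transpose_transpose]

theorem braidMatrixInv_mul_braidMatrix (hε : ε * ε = 1) :
    braidMatrixInv h ε * braidMatrix (n := n) h ε = 1 := by
  ext x y
  obtain ⟨x, hx⟩ := x
  obtain ⟨y, hy⟩ := y
  rw [mul_braidMatrix]
  simp only [braidMatrixInv, bandCycle, Matrix.of_apply, Matrix.one_apply, Pi.single_apply,
    Pi.add_apply, Pi.sub_apply, Subtype.mk.injEq, Sum.inr.injEq]
  grind

end Braid

theorem entry_braid {n a m i : ℕ} (h : a + 2 < m) {ε : ℤ} (hε : ε * ε = 1) {w w' : List Letter}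
    (hc0 : colOf w a = i) (hc1 : colOf w (a + 1) = i + 1) (hc2 : colOf w (a + 2) = i)
    (hs0 : signOf w a = ε) (hs1 : signOf w (a + 1) = ε) (hs2 : signOf w (a + 2) = ε)
    (hc0' : colOf w' a = i + 1) (hc1' : colOf w' (a + 1) = i) (hc2' : colOf w' (a + 2) = i + 1)
    (hs0' : signOf w' a = ε) (hs1' : signOf w' (a + 1) = ε) (hs2' : signOf w' (a + 2) = ε)
    (hcol : ∀ k, k ≠ a → k ≠ a + 1 → k ≠ a + 2 → colOf w' k = colOf w k)
    (hsign : ∀ k, k ≠ a → k ≠ a + 1 → k ≠ a + 2 → signOf w' k = signOf w k) :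
    (Matrix.of fun x y : cycleFinset n m => entry w' x y) =
      (braidMatrix (n := n) h ε)ᵀ * (Matrix.of fun x y : cycleFinset n m => entry w x y)
        * braidMatrix (n := n) h ε := by
  ext x y
  obtain ⟨x, hx⟩ := x
  obtain ⟨y, hy⟩ := y
  rw [transpose_braidMatrix_mul_mul, mul_braidMatrix]
  simp only [Matrix.transpose_apply, mul_braidMatrix, Matrix.of_apply, bandCycle]
  rcases x with j | k <;> rcases y with j' | l <;>
    simp only [reduceCtorEq, if_false, entry, Sum.inr.injEq]
  · grind
  · grind
  · rcases eq_or_ne k a with rfl | h0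
    · rcases eq_or_ne l k with rfl | h0' <;> grind
    · grind

/-- **type III Reidemeister move M4.** The linking matrices of braid
words related by `σ_i σ_{i+1} σ_i = σ_{i+1} σ_i σ_{i+1}` (both signs `ε`) are
unimodular-congruent. -/
theorem linkMat_reidemeisterIII_unimodular_congruent (n : ℕ) (u v : List Letter)
    (i : ℕ) (hi : 1 ≤ i ∧ i ≤ n - 2) (ε : ℤ) (hε : ε = 1 ∨ ε = -1)
    (hw : IsBraidWord n (u ++ [(i, ε), (i + 1, ε), (i, ε)] ++ v))
    (hw' : IsBraidWord n (u ++ [(i + 1, ε), (i, ε), (i + 1, ε)] ++ v)) :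
    ∃ P : Matrix (Fin (n + (u.length + 3 + v.length)))
        (Fin (n + (u.length + 3 + v.length))) ℤ,
      (P.det = 1 ∨ P.det = -1) ∧
      linkMat n (u.length + 3 + v.length) (u ++ [(i + 1, ε), (i, ε), (i + 1, ε)] ++ v) =
        Pᵀ * linkMat n (u.length + 3 + v.length) (u ++ [(i, ε), (i + 1, ε), (i, ε)] ++ v)
          * P := by
  have hε' : ε * ε = 1 := by rcases hε with rfl | rfl <;> rfl
  obtain ⟨e, he⟩ := exists_linkMat_eq_submatrix (m := u.length + 3 + v.length) hw
    (by simp; omega)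
  obtain ⟨f, hf⟩ := exists_linkMat_eq_submatrix (m := u.length + 3 + v.length) hw'
    (by simp; omega)
  have h : u.length + 2 < u.length + 3 + v.length := by omega
  refine ⟨(braidMatrix (n := n) h ε).submatrix e f, ?_, ?_⟩
  · rw [← Int.isUnit_iff, ← Matrix.isUnit_iff_isUnit_det]
    refine .of_mul_eq_one_right ((braidMatrixInv h ε).submatrix f e) ?_
    rw [Matrix.submatrix_mul_equiv, braidMatrixInv_mul_braidMatrix h ε hε',
      Matrix.submatrix_one_equiv]
  · rw [he, hf]
    refine Matrix.submatrix_congruence (entry_braid (i := i) h hε' ?_ ?_ ?_ ?_ ?_ ?_ ?_ ?_ ?_ ?_ ?_ ?_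
      ?_ ?_) e f
    iterate 12 simp [colOf, signOf]
    all_goals
      intro k h0 h1 h2
      have hk : k < u.length ∨ ∃ j, k = u.length + (j + 3) := by
        rcases lt_or_ge k u.length with hlt | hge
        · exact Or.inl hlt
        · exact Or.inr ⟨k - u.length - 3, by omega⟩
      rcases hk with hk | ⟨j, rfl⟩
      · simp [colOf, signOf, List.getElem?_append, hk]
      · simp [colOf, signOf, List.getElem?_append]
end
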